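/- Let u be a smooth (0,q)-form on Ω∖Z that is ∂̄-closed, with q < k−1, where Ω = Ω′×Ω″ ⊆ C^{n−k}×C^k and Z is contained in a compact-in-the-second-factor set K = Ω′ × closure(rB). In the case q = 0: every holomorphic function on Ω∖K extends uniquely to a holomorphic function on all of Ω (Hartogs phenomenon for product domains with k ≥ 2). -/

import Mathlib

open Metric

open Set Filter Topology MeasureTheory in
/-- Circle integrals depend holomorphically on a finite-dimensional holomorphic parameter. -/
lemma hartogs_param {E : Type*} [NormedAddCommGroup E] [NormedSpace ℂ E] [FiniteDimensional ℂ E]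
    (g : E × ℂ → ℂ) (V : Set (E × ℂ)) (hV : IsOpen V) (hg : DifferentiableOn ℂ g V)
    (p₀ : E) (ρ : ℝ) (hρ : 0 ≤ ρ) (hsub : ∀ ζ ∈ sphere (0 : ℂ) ρ, (p₀, ζ) ∈ V) :
    DifferentiableAt ℂ (fun p => ∮ ζ in C(0, ρ), g (p, ζ)) p₀ := by
  have hK : IsCompact (({p₀} : Set E) ×ˢ sphere (0 : ℂ) ρ) :=
    isCompact_singleton.prod (isCompact_sphere _ _)
  have hKV : (({p₀} : Set E) ×ˢ sphere (0 : ℂ) ρ) ⊆ V := by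
    rintro ⟨p, ζ⟩ ⟨hp, hζ⟩
    have hp' : p = p₀ := hp
    subst hp'
    exact hsub ζ hζ
  obtain ⟨M, hM⟩ := hK.exists_bound_of_continuousOn (hg.continuousOn.mono hKV)
  have hW : IsOpen (V ∩ g ⁻¹' ball 0 (M + 1)) :=
    hg.continuousOn.isOpen_inter_preimage hV isOpen_ball
  obtain ⟨u, v, hu, hv, hpu, hsv, huv⟩ := generalized_tube_lemma isCompact_singleton
    (isCompact_sphere (0 : ℂ) ρ) hW (s := {p₀}) (by
      intro q hq
      refine ⟨hKV hq, ?_⟩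
      have := hM q hq
      simp only [mem_preimage, mem_ball_zero_iff]
      linarith)
  obtain ⟨δ, hδ, hδu⟩ := Metric.isOpen_iff.1 hu p₀ (hpu rfl)
  have hγ : ∀ θ, circleMap 0 ρ θ ∈ v := fun θ => hsv (circleMap_mem_sphere 0 hρ θ)
  have hmem : ∀ p ∈ ball p₀ δ, ∀ θ, (p, circleMap 0 ρ θ) ∈ V ∧ ‖g (p, circleMap 0 ρ θ)‖ < M + 1 := by
    intro p hp θ
    have := huv (show (p, circleMap 0 ρ θ) ∈ u ×ˢ v from ⟨hδu hp, hγ θ⟩)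
    exact ⟨this.1, by simpa using this.2⟩
  let Φ : E → ℝ → ℂ := fun p θ => deriv (circleMap 0 ρ) θ • g (p, circleMap 0 ρ θ)
  have hcont : ∀ p ∈ ball p₀ δ, Continuous (Φ p) := by
    intro p hp
    have h1 : Continuous (fun θ => g (p, circleMap 0 ρ θ)) := by
      refine hg.continuousOn.comp_continuous (by fun_prop) (fun θ => (hmem p hp θ).1)
    have h2 : Continuous (deriv (circleMap 0 ρ)) := by
      have : deriv (circleMap 0 ρ) = fun θ => circleMap 0 ρ θ * Complex.I := by
        ext θ; simp
      rw [this]; fun_prop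
    exact h2.smul h1
  have hdiff : ∀ p ∈ ball p₀ δ, ∀ θ, DifferentiableAt ℂ (fun p => Φ p θ) p := by
    intro p hp θ
    have h1 : DifferentiableAt ℂ g (p, circleMap 0 ρ θ) :=
      hg.differentiableAt (hV.mem_nhds (hmem p hp θ).1)
    have h2 : DifferentiableAt ℂ (fun p : E => (p, circleMap 0 ρ θ)) p := by fun_prop
    have h3 : DifferentiableAt ℂ (fun p : E => g (p, circleMap 0 ρ θ)) p :=
      DifferentiableAt.comp p h1 h2
    exact h3.fun_const_smul (deriv (circleMap 0 ρ) θ)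
  have hsub2 : ∀ x ∈ ball p₀ (δ/2), ball x (δ/2) ⊆ ball p₀ δ := by
    intro x hx
    apply ball_subset_ball'
    have := mem_ball.1 hx
    linarith
  have hx0 : p₀ ∈ ball p₀ (δ/2) := mem_ball_self (by positivity)
  have hnorm : ∀ x ∈ ball p₀ δ, ∀ θ, ‖Φ x θ‖ ≤ ρ * (M + 1) := by
    intro x hx θ
    have : ‖deriv (circleMap 0 ρ) θ‖ = ρ := by simp [abs_of_nonneg hρ]
    simp only [Φ, norm_smul, this]
    exact mul_le_mul_of_nonneg_left (hmem x hx θ).2.le hρ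
  have key := intervalIntegral.hasFDerivAt_integral_of_dominated_of_fderiv_le (𝕜 := ℂ)
    (μ := volume) (a := 0) (b := 2 * Real.pi)
    (F := Φ) (F' := fun p θ => fderiv ℂ (fun p => Φ p θ) p) (x₀ := p₀) (s := ball p₀ (δ/2))
    (bound := fun _ => (2 * (ρ * (M+1))) / (δ/2)) (ball_mem_nhds _ (by positivity))
    (by
      filter_upwards [ball_mem_nhds p₀ hδ] with x hx
      exact (hcont x hx).aestronglyMeasurable)
    ((hcont p₀ (mem_ball_self hδ)).intervalIntegrable _ _)
    (by
      let b := Module.finBasis ℂ E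
      have hrepr : (fun θ => fderiv ℂ (fun p => Φ p θ) p₀) = fun θ => ∑ i,
          (fderiv ℂ (fun p => Φ p θ) p₀ (b i)) • (LinearMap.toContinuousLinearMap (b.coord i)) := by
        ext θ x
        conv_lhs => rw [← b.sum_repr x, map_sum]
        simp [mul_comm]
      rw [hrepr]
      refine Finset.aestronglyMeasurable_fun_sum _ fun i _ => ?_
      refine AEStronglyMeasurable.smul_const ?_ _
      have hlim : Tendsto (fun n : ℕ => p₀ + ((n:ℂ)+1)⁻¹ • b i) atTop (𝓝 p₀) := by
        have : Tendsto (fun n : ℕ => ((n:ℂ)+1)⁻¹) atTop (𝓝 0) := by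
          simpa using (tendsto_one_div_add_atTop_nhds_zero_nat (𝕜 := ℂ))
        simpa using tendsto_const_nhds.add (this.smul_const (b i))
      obtain ⟨N, hN⟩ := eventually_atTop.1 (hlim.eventually (ball_mem_nhds p₀ hδ))
      refine aestronglyMeasurable_of_tendsto_ae atTop
        (f := fun (n:ℕ) θ => (((n+N : ℕ):ℂ)+1) • (Φ (p₀ + (((n+N:ℕ):ℂ)+1)⁻¹ • b i) θ - Φ p₀ θ))
        (fun n => ?_) (ae_of_all _ fun θ => ?_)
      · have c1 := hcont _ (hN (n+N) (by omega))
        have c2 := hcont p₀ (mem_ball_self hδ)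
        exact Continuous.aestronglyMeasurable (by fun_prop)
      · have h := (hdiff p₀ (mem_ball_self hδ) θ).hasFDerivAt
        have h3 := h.lim (b i) (c := fun n : ℕ => ((n:ℂ)+1)) (l := atTop) (by
          have := (tendsto_natCast_atTop_atTop (R := ℝ)).atTop_add (tendsto_const_nhds (x := (1:ℝ)))
          refine this.congr fun n => ?_
          rw [show ((n:ℂ)+1) = ((n+1:ℝ):ℂ) by push_cast; rfl, Complex.norm_real, Real.norm_of_nonneg (by positivity)])
        exact (tendsto_add_atTop_iff_nat N).2 h3)
    (ae_of_all _ fun θ _ x hx => by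
      refine Complex.norm_fderiv_le_div_of_mapsTo_ball ?_ ?_ (by positivity)
      · intro y hy
        exact (hdiff y (hsub2 x hx hy) θ).differentiableWithinAt
      · intro y hy
        rw [mem_closedBall, dist_eq_norm]
        have h1 := hnorm y (hsub2 x hx hy) θ
        have h2 := hnorm x (hsub2 x hx (mem_ball_self (by positivity))) θ
        have := norm_sub_le (Φ y θ) (Φ x θ)
        linarith)
    (by simp)
    (ae_of_all _ fun θ _ x hx => (hdiff x (hsub2 x hx (mem_ball_self (by positivity))) θ).hasFDerivAt)
  exact key.differentiableAt

open Set Filter Topology in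
/-- Identity theorem for holomorphic functions of several variables. -/
lemma hartogs_identity {E : Type*} [NormedAddCommGroup E] [NormedSpace ℂ E]
    (f g : E → ℂ) (U : Set E) (hU : IsOpen U) (hc : IsPreconnected U)
    (hf : DifferentiableOn ℂ f U) (hg : DifferentiableOn ℂ g U)
    (x₀ : E) (hx₀ : x₀ ∈ U) (h : f =ᶠ[𝓝 x₀] g) : EqOn f g U := by
  have hS : IsOpen {x | f =ᶠ[𝓝 x] g} := isOpen_setOfPred_eventually_nhds
  have := hc.subset_of_closure_inter_subset hS ⟨x₀, hx₀, h⟩ (by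
    rintro x ⟨hx, hxU⟩
    obtain ⟨δ, hδ, hδU⟩ := Metric.isOpen_iff.1 hU x hxU
    obtain ⟨y, hy, hyx⟩ := Metric.mem_closure_iff.1 hx δ hδ
    rw [dist_comm] at hyx
    refine eventually_of_mem (ball_mem_nhds x hδ) fun z hz => ?_
    let φ : ℂ → E := fun t => y + t • (z - y)
    have hφd : Differentiable ℂ φ := by fun_prop
    have hφc : Continuous φ := hφd.continuous
    have hpre : IsOpen (φ ⁻¹' ball x δ) := isOpen_ball.preimage hφc
    have hconv : Convex ℝ (φ ⁻¹' ball x δ) := by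
      let _ : NormedSpace ℝ E := NormedSpace.restrictScalars ℝ ℂ E
      intro s hs t ht a b ha hb hab
      have hcb := convex_ball x δ hs ht ha hb hab
      have : φ (a • s + b • t) = a • φ s + b • φ t := by
        have e : ∀ (c : ℝ) (v : E), c • v = (c : ℂ) • v := fun c v => rfl
        have hab' : (a : ℂ) + b = 1 := by exact_mod_cast hab
        simp only [φ, e]
        simp only [Complex.real_smul]
        have : b = 1 - a := by linarith
        subst this
        push_cast
        module
      show φ _ ∈ ball x δ
      rw [this]; exact hcb
    have h1 : ∀ F : E → ℂ, DifferentiableOn ℂ F U → AnalyticOnNhd ℂ (F ∘ φ) (φ ⁻¹' ball x δ) := by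
      intro F hF
      refine DifferentiableOn.analyticOnNhd ?_ hpre
      exact (hF.mono hδU).comp hφd.differentiableOn (fun t ht => ht)
    have h0 : (0:ℂ) ∈ φ ⁻¹' ball x δ := by simpa [φ] using hyx
    have h1' : (1:ℂ) ∈ φ ⁻¹' ball x δ := by simpa [φ] using hz
    have hev : (f ∘ φ) =ᶠ[𝓝 0] (g ∘ φ) := by
      have : Tendsto φ (𝓝 0) (𝓝 y) := by
        have := hφc.tendsto 0
        simpa [φ] using this
      exact this.eventually hy
    have := (h1 f hf).eqOn_of_preconnected_of_eventuallyEq (h1 g hg) hconv.isPreconnected h0 hev h1'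
    simpa [φ] using this)
  intro x hx
  exact (this hx).self_of_nhds

open Set in
lemma hartogs_annulus (g : ℂ → ℂ) (a : ℂ) (ρ₁ ρ₂ : ℝ) (ha : ‖a‖ < ρ₁) (h12 : ρ₁ ≤ ρ₂)
    (hg : ∀ ζ : ℂ, ρ₁ ≤ ‖ζ‖ → ‖ζ‖ ≤ ρ₂ → DifferentiableAt ℂ g ζ) :
    (∮ ζ in C(0, ρ₂), (ζ - a)⁻¹ • g ζ) = ∮ ζ in C(0, ρ₁), (ζ - a)⁻¹ • g ζ := by
  have hd : ∀ ζ : ℂ, ρ₁ ≤ ‖ζ‖ → ‖ζ‖ ≤ ρ₂ → DifferentiableAt ℂ (fun ζ => (ζ - a)⁻¹ • g ζ) ζ := by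
    intro ζ h1 h2
    have hne : ζ - a ≠ 0 := by
      intro h
      rw [sub_eq_zero.1 h] at h1
      linarith
    exact ((differentiableAt_id.sub_const a).inv hne).smul (hg ζ h1 h2)
  refine Complex.circleIntegral_eq_of_differentiable_on_annulus_off_countable
    (lt_of_le_of_lt (norm_nonneg a) ha) h12 countable_empty ?_ ?_
  · intro ζ hζ
    have : ‖ζ‖ ≤ ρ₂ ∧ ρ₁ ≤ ‖ζ‖ := by simpa using hζ
    exact (hd ζ this.2 this.1).continuousAt.continuousWithinAt
  · intro ζ hζ
    have : ‖ζ‖ < ρ₂ ∧ ρ₁ < ‖ζ‖ := by simpa using hζ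
    exact hd ζ this.2.le this.1.le

lemma hartogs_shell {k : ℕ} (hk : 2 ≤ k) (r R : ℝ) (hr : 0 ≤ r) :
    IsPreconnected {w : EuclideanSpace ℂ (Fin k) | r < ‖w‖ ∧ ‖w‖ < R} := by
  have hrank : 1 < Module.rank ℝ (EuclideanSpace ℂ (Fin k)) := by
    rw [← Module.finrank_eq_rank, ← Module.finrank_mul_finrank ℝ ℂ]
    simp
    norm_cast
    omega
  have h1 := isPreconnected_sphere hrank 0 1
  have h2 : IsPreconnected (Set.Ioo r R) := isPreconnected_Ioo
  have h3 := (h2.prod h1).image (fun q : ℝ × EuclideanSpace ℂ (Fin k) => q.1 • q.2)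
    (by fun_prop)
  convert h3 using 1
  ext w
  constructor
  · rintro ⟨h, h'⟩
    have hpos : 0 < ‖w‖ := lt_of_le_of_lt hr h
    refine ⟨(‖w‖, ‖w‖⁻¹ • w), ⟨⟨h, h'⟩, ?_⟩, ?_⟩
    · simp [norm_smul, hpos.ne']
    · simp [smul_smul, hpos.ne']
  · rintro ⟨⟨t, v⟩, ⟨⟨h, h'⟩, hv⟩, rfl⟩
    have hv' : ‖v‖ = 1 := by simpa using hv
    have ht : 0 < t := lt_of_le_of_lt hr h
    simp only [Set.mem_ofPred_eq, norm_smul, hv', mul_one, Real.norm_of_nonneg ht.le]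
    exact ⟨h, h'⟩


lemma hartogs_norm_sq {k : ℕ} (i : Fin k) (w : EuclideanSpace ℂ (Fin k)) (ζ : ℂ) :
    ‖w + (ζ - w i) • EuclideanSpace.single i (1 : ℂ)‖ ^ 2 = ‖ζ‖ ^ 2 + (‖w‖ ^ 2 - ‖w i‖ ^ 2) := by
  rw [EuclideanSpace.norm_sq_eq, EuclideanSpace.norm_sq_eq,
    ← Finset.add_sum_erase _ _ (Finset.mem_univ i), ← Finset.add_sum_erase _ _ (Finset.mem_univ i)]
  have h : ∀ j ∈ Finset.univ.erase i,
      ‖(w + (ζ - w i) • EuclideanSpace.single i (1 : ℂ)) j‖ ^ 2 = ‖w j‖ ^ 2 := by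
    intro j hj
    have : j ≠ i := (Finset.mem_erase.1 hj).1
    simp [this]
  rw [Finset.sum_congr rfl h]
  simp

open Set Filter Topology in
/-- Local form: extension across the ball `‖w‖ ≤ r` inside the ball `‖w‖ < R`. -/
lemma hartogs_local {l k : ℕ} (hk : 2 ≤ k) (Ω' : Set (EuclideanSpace ℂ (Fin l)))
    (hΩ' : IsOpen Ω') (r R : ℝ) (hr : 0 < r) (hrR : r < R)
    (f : EuclideanSpace ℂ (Fin l) × EuclideanSpace ℂ (Fin k) → ℂ)
    (hf : ∀ z ∈ Ω', ∀ w, r < ‖w‖ → ‖w‖ < R → DifferentiableAt ℂ f (z, w)) :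
    ∃ F : EuclideanSpace ℂ (Fin l) × EuclideanSpace ℂ (Fin k) → ℂ,
      (∀ z ∈ Ω', ∀ w, ‖w‖ < R → DifferentiableAt ℂ F (z, w)) ∧
      (∀ z ∈ Ω', ∀ w, r < ‖w‖ → ‖w‖ < R → F (z, w) = f (z, w)) := by
  let i : Fin k := ⟨0, by omega⟩
  let j : Fin k := ⟨1, by omega⟩
  have hij : i ≠ j := by simp [i, j]
  let σ : EuclideanSpace ℂ (Fin k) → ℂ → EuclideanSpace ℂ (Fin k) :=
    fun w ζ => w + (ζ - w i) • EuclideanSpace.single i (1 : ℂ)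
  let m : EuclideanSpace ℂ (Fin k) → ℝ := fun w => ‖w‖ ^ 2 - ‖w i‖ ^ 2
  have hm0 : ∀ w, 0 ≤ m w := by
    intro w
    have := PiLp.norm_apply_le w i
    have h2 := pow_le_pow_left₀ (norm_nonneg _) this 2
    simp only [m]; linarith
  have hσ : ∀ w ζ, ‖σ w ζ‖ ^ 2 = ‖ζ‖ ^ 2 + m w := fun w ζ => hartogs_norm_sq i w ζ
  have hσd : Differentiable ℂ
      (fun q : EuclideanSpace ℂ (Fin k) × ℂ => σ q.1 q.2) := by
    have hco : Differentiable ℂ (fun q : EuclideanSpace ℂ (Fin k) × ℂ => q.1 i) :=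
      (EuclideanSpace.proj (𝕜 := ℂ) i).differentiable.comp differentiable_fst
    exact differentiable_fst.add ((differentiable_snd.sub hco).smul_const _)
  have hσw : ∀ w, σ w (w i) = w := by intro w; simp [σ]
  -- membership in the shell
  have hin : ∀ z ∈ Ω', ∀ w ζ, r ^ 2 < ‖ζ‖ ^ 2 + m w → ‖ζ‖ ^ 2 + m w < R ^ 2 →
      DifferentiableAt ℂ f (z, σ w ζ) := by
    intro z hz w ζ h1 h2
    rw [← hσ] at h1 h2
    exact hf z hz _ (lt_of_pow_lt_pow_left₀ 2 (norm_nonneg _) h1)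
      (lt_of_pow_lt_pow_left₀ 2 (by linarith) h2)
  let I : ℝ → EuclideanSpace ℂ (Fin l) × EuclideanSpace ℂ (Fin k) → ℂ := fun ρ p =>
    (2 * Real.pi * Complex.I : ℂ)⁻¹ • ∮ ζ in C(0, ρ), (ζ - p.2 i)⁻¹ • f (p.1, σ p.2 ζ)
  let ok : ℝ → EuclideanSpace ℂ (Fin k) → Prop := fun ρ w =>
    ‖w i‖ < ρ ∧ r ^ 2 < ρ ^ 2 + m w ∧ ρ ^ 2 + m w < R ^ 2
  have hslice : ∀ z ∈ Ω', ∀ w ζ, r ^ 2 < ‖ζ‖ ^ 2 + m w → ‖ζ‖ ^ 2 + m w < R ^ 2 →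
      DifferentiableAt ℂ (fun ζ => f (z, σ w ζ)) ζ := by
    intro z hz w ζ h1 h2
    have h3 := hin z hz w ζ h1 h2
    have h4 : DifferentiableAt ℂ (fun ζ => (z, σ w ζ)) ζ := by
      have : Differentiable ℂ (fun ζ => σ w ζ) :=
        hσd.comp ((differentiable_const w).prodMk differentiable_id)
      exact (differentiableAt_const z).prodMk (this ζ)
    exact DifferentiableAt.comp ζ h3 h4
  have hindep' : ∀ z ∈ Ω', ∀ w ρ₁ ρ₂, ok ρ₁ w → ok ρ₂ w → ρ₁ ≤ ρ₂ → I ρ₂ (z, w) = I ρ₁ (z, w) := by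
    intro z hz w ρ₁ ρ₂ h1 h2 h12
    simp only [I]
    congr 1
    refine hartogs_annulus (fun ζ => f (z, σ w ζ)) (w i) ρ₁ ρ₂ h1.1 h12 fun ζ ha hb => ?_
    have hp : 0 ≤ ρ₁ := (norm_nonneg _).trans h1.1.le
    have e1 := pow_le_pow_left₀ hp ha 2
    have e2 := pow_le_pow_left₀ (norm_nonneg _) hb 2
    exact hslice z hz w ζ (by linarith [h1.2.1]) (by linarith [h2.2.2])
  have hindep : ∀ z ∈ Ω', ∀ w ρ₁ ρ₂, ok ρ₁ w → ok ρ₂ w → I ρ₁ (z, w) = I ρ₂ (z, w) := by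
    intro z hz w ρ₁ ρ₂ h1 h2
    rcases le_total ρ₁ ρ₂ with h | h
    · exact (hindep' z hz w ρ₁ ρ₂ h1 h2 h).symm
    · exact hindep' z hz w ρ₂ ρ₁ h2 h1 h
  have hex : ∀ w : EuclideanSpace ℂ (Fin k), ‖w‖ < R → ∃ ρ, ok ρ w := by
    intro w hw
    obtain ⟨s, hs1, hs2⟩ := exists_between (max_lt hrR hw)
    have hsr : r < s := (le_max_left _ _).trans_lt hs1
    have hsw : ‖w‖ < s := (le_max_right _ _).trans_lt hs1
    have e1 := pow_lt_pow_left₀ hsw (norm_nonneg _) (two_ne_zero)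
    have e2 := pow_lt_pow_left₀ hsr hr.le (two_ne_zero)
    have e3 := pow_lt_pow_left₀ hs2 (hr.trans hsr).le (two_ne_zero)
    have hnn : 0 ≤ s ^ 2 - m w := by
      simp only [m]; nlinarith [sq_nonneg ‖w i‖]
    refine ⟨Real.sqrt (s ^ 2 - m w), ?_, ?_, ?_⟩
    · apply Real.lt_sqrt_of_sq_lt
      simp only [m]; linarith
    · rw [Real.sq_sqrt hnn]; linarith
    · rw [Real.sq_sqrt hnn]; linarith
  have hmc : Continuous m := by fun_prop
  have hopen : ∀ ρ, IsOpen {w | ok ρ w} := by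
    intro ρ
    have c1 : Continuous (fun w : EuclideanSpace ℂ (Fin k) => ‖w i‖) := by fun_prop
    exact (isOpen_lt c1 continuous_const).inter
      ((isOpen_lt continuous_const (continuous_const.add hmc)).inter
        (isOpen_lt (continuous_const.add hmc) continuous_const))
  have hId : ∀ ρ, ∀ z ∈ Ω', ∀ w, ok ρ w → DifferentiableAt ℂ (I ρ) (z, w) := by
    intro ρ z hz w hw
    have hρ : 0 ≤ ρ := (norm_nonneg _).trans hw.1.le
    suffices hs : DifferentiableAt ℂ (fun p : EuclideanSpace ℂ (Fin l) × EuclideanSpace ℂ (Fin k) =>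
        ∮ ζ in C(0, ρ), (ζ - p.2 i)⁻¹ • f (p.1, σ p.2 ζ)) (z, w) from
      hs.fun_const_smul (2 * Real.pi * Complex.I : ℂ)⁻¹
    have hco : Continuous (fun q : (EuclideanSpace ℂ (Fin l) × EuclideanSpace ℂ (Fin k)) × ℂ =>
      q.1.2 i) := by fun_prop
    refine hartogs_param (fun q : (EuclideanSpace ℂ (Fin l) × EuclideanSpace ℂ (Fin k)) × ℂ =>
      (q.2 - q.1.2 i)⁻¹ • f (q.1.1, σ q.1.2 q.2))
      {q | q.1.1 ∈ Ω' ∧ q.2 - q.1.2 i ≠ 0 ∧ r ^ 2 < ‖q.2‖ ^ 2 + m q.1.2 ∧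
        ‖q.2‖ ^ 2 + m q.1.2 < R ^ 2} ?_ ?_ (z, w) ρ hρ ?_
    · have c2 : Continuous (fun q : (EuclideanSpace ℂ (Fin l) × EuclideanSpace ℂ (Fin k)) × ℂ =>
        ‖q.2‖ ^ 2 + m q.1.2) := by fun_prop
      exact (hΩ'.preimage (continuous_fst.comp continuous_fst)).inter
        ((isOpen_ne.preimage (continuous_snd.sub hco)).inter
        ((isOpen_lt continuous_const c2).inter (isOpen_lt c2 continuous_const)))
    · rintro ⟨⟨z', w'⟩, ζ⟩ ⟨h1, h2, h3, h4⟩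
      refine DifferentiableAt.differentiableWithinAt ?_
      have hcod : Differentiable ℂ
          (fun q : (EuclideanSpace ℂ (Fin l) × EuclideanSpace ℂ (Fin k)) × ℂ => q.1.2 i) :=
        (EuclideanSpace.proj (𝕜 := ℂ) i).differentiable.comp
          (differentiable_snd.comp differentiable_fst)
      have d1 : DifferentiableAt ℂ
          (fun q : (EuclideanSpace ℂ (Fin l) × EuclideanSpace ℂ (Fin k)) × ℂ =>
            (q.2 - q.1.2 i)⁻¹) ((z', w'), ζ) :=
        ((differentiable_snd.sub hcod) _).inv h2
      have d2 : Differentiable ℂ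
          (fun q : (EuclideanSpace ℂ (Fin l) × EuclideanSpace ℂ (Fin k)) × ℂ =>
            (q.1.1, σ q.1.2 q.2)) :=
        (differentiable_fst.comp differentiable_fst).prodMk
          (hσd.comp (f := fun q : (EuclideanSpace ℂ (Fin l) × EuclideanSpace ℂ (Fin k)) × ℂ =>
            (q.1.2, q.2)) (by fun_prop))
      have d3 : DifferentiableAt ℂ
          (fun q : (EuclideanSpace ℂ (Fin l) × EuclideanSpace ℂ (Fin k)) × ℂ =>
            f (q.1.1, σ q.1.2 q.2)) ((z', w'), ζ) :=
        DifferentiableAt.comp ((z', w'), ζ) (hin z' h1 w' ζ h3 h4) (d2 _)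
      exact d1.smul d3
    · intro ζ hζ
      have hζ' : ‖ζ‖ = ρ := by simpa using hζ
      refine ⟨hz, ?_, ?_, ?_⟩
      · intro h
        have h' : ζ = w i := sub_eq_zero.1 h
        rw [h'] at hζ'
        exact absurd hw.1 (by rw [hζ']; exact lt_irrefl _)
      · show r ^ 2 < ‖ζ‖ ^ 2 + m w
        rw [hζ']; exact hw.2.1
      · show ‖ζ‖ ^ 2 + m w < R ^ 2
        rw [hζ']; exact hw.2.2
  classical
  let ρc : EuclideanSpace ℂ (Fin k) → ℝ := fun w => if h : ‖w‖ < R then (hex w h).choose else 0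
  have hρc : ∀ w, ‖w‖ < R → ok (ρc w) w := by
    intro w hw
    simp only [ρc, hw, dite_true]
    exact (hex w hw).choose_spec
  let F : EuclideanSpace ℂ (Fin l) × EuclideanSpace ℂ (Fin k) → ℂ := fun p => I (ρc p.2) p
  have hFd : ∀ z ∈ Ω', ∀ w, ‖w‖ < R → DifferentiableAt ℂ F (z, w) := by
    intro z hz w hw
    refine (hId (ρc w) z hz w (hρc w hw)).congr_of_eventuallyEq ?_
    have hO : IsOpen (Ω' ×ˢ ({w' | ok (ρc w) w'} ∩ ball 0 R)) :=
      hΩ'.prod ((hopen _).inter isOpen_ball)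
    filter_upwards [hO.mem_nhds (show (z, w) ∈ _ from ⟨hz, hρc w hw, by simpa using hw⟩)]
    rintro ⟨z', w'⟩ ⟨h1, h2, h3⟩
    exact hindep z' h1 w' _ _ (hρc w' (by simpa using h3)) h2
  refine ⟨F, hFd, ?_⟩
  intro z hz w hw1 hw2
  have hshell : IsOpen {w : EuclideanSpace ℂ (Fin k) | r < ‖w‖ ∧ ‖w‖ < R} :=
    (isOpen_lt continuous_const continuous_norm).inter (isOpen_lt continuous_norm continuous_const)
  have hpair : ∀ w : EuclideanSpace ℂ (Fin k), DifferentiableAt ℂ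
      (fun w : EuclideanSpace ℂ (Fin k) => (z, w)) w := fun w => by fun_prop
  -- agreement where the whole slice disc lies in the domain
  have heq : ∀ w, r ^ 2 < m w → ‖w‖ < R → F (z, w) = f (z, w) := by
    intro w h1 h2
    have hok := hρc w h2
    have hd : DifferentiableOn ℂ (fun ζ => f (z, σ w ζ)) (closedBall 0 (ρc w)) := by
      intro ζ hζ
      have e := pow_le_pow_left₀ (norm_nonneg _) (mem_closedBall_zero_iff.1 hζ) 2
      exact (hslice z hz w ζ (by nlinarith [sq_nonneg ‖ζ‖])
        (by linarith [hok.2.2])).differentiableWithinAt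
    have := hd.circleIntegral_sub_inv_smul (w := w i) (by simpa using hok.1)
    simp only [F, I]
    rw [this, hσw, smul_smul, inv_mul_cancel₀ Complex.two_pi_I_ne_zero, one_smul]
  let s := (r + R) / 2
  have hs0 : 0 ≤ s := by simp only [s]; linarith
  let w₀ : EuclideanSpace ℂ (Fin k) := EuclideanSpace.single j (s : ℂ)
  have hw0n : ‖w₀‖ = s := by simp [w₀, abs_of_nonneg hs0]
  have hw0i : w₀ i = 0 := by simp [w₀, hij]
  have hw0m : m w₀ = s ^ 2 := by simp [m, hw0n, hw0i]
  have hrs : r < s := by simp only [s]; linarith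
  have hsR : s < R := by simp only [s]; linarith
  refine hartogs_identity (fun w => F (z, w)) (fun w => f (z, w))
    {w : EuclideanSpace ℂ (Fin k) | r < ‖w‖ ∧ ‖w‖ < R} hshell (hartogs_shell hk r R hr.le)
    ?_ ?_ w₀ ⟨by rw [hw0n]; exact hrs, by rw [hw0n]; exact hsR⟩ ?_ ⟨hw1, hw2⟩
  · intro w hw
    exact (DifferentiableAt.comp w (hFd z hz w hw.2) (hpair w)).differentiableWithinAt
  · intro w hw
    exact (DifferentiableAt.comp w (hf z hz w hw.1 hw.2) (hpair w)).differentiableWithinAt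
  · have hO : IsOpen {w : EuclideanSpace ℂ (Fin k) | r ^ 2 < m w ∧ ‖w‖ < R} :=
      (isOpen_lt continuous_const hmc).inter (isOpen_lt continuous_norm continuous_const)
    filter_upwards [hO.mem_nhds (show w₀ ∈ _ from
      ⟨by rw [hw0m]; exact pow_lt_pow_left₀ hrs hr.le two_ne_zero, by rw [hw0n]; exact hsR⟩)]
    intro w hw
    exact heq w hw.1 hw.2

/-- Hartogs phenomenon for product domains (the case `q = 0` of the paper's variant of
Hartogs' phenomenon): write `ℂⁿ = ℂ^{n-k} × ℂ^k` with `k ≥ 2`, let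
`Ω = Ω′ × Ω″` with `Ω′ ⊆ ℂ^{n-k}`, `Ω″ ⊆ ℂ^k` open, `Ω″` a domain (connected), and let
`K = Ω′ × closure(rB)` where `rB` is the Euclidean ball of radius `r < 1` with
`closure(rB) ⊂ Ω″`.  Then every holomorphic function on `Ω ∖ K` extends uniquely to a
holomorphic function on all of `Ω`. -/
theorem hartogs_extension_product
    (l k : ℕ) (hk : 2 ≤ k)
    (Ω' : Set (EuclideanSpace ℂ (Fin l))) (hΩ' : IsOpen Ω')
    (Ω'' : Set (EuclideanSpace ℂ (Fin k))) (hΩ'' : IsOpen Ω'') (hconn : IsConnected Ω'')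
    (r : ℝ) (hr0 : 0 < r) (hr1 : r < 1)
    (hball : closedBall (0 : EuclideanSpace ℂ (Fin k)) r ⊆ Ω'')
    (f : EuclideanSpace ℂ (Fin l) × EuclideanSpace ℂ (Fin k) → ℂ)
    (hf : DifferentiableOn ℂ f ((Ω' ×ˢ Ω'') \ (Ω' ×ˢ closedBall 0 r))) :
    ∃ F : EuclideanSpace ℂ (Fin l) × EuclideanSpace ℂ (Fin k) → ℂ,
      DifferentiableOn ℂ F (Ω' ×ˢ Ω'') ∧
      Set.EqOn F f ((Ω' ×ˢ Ω'') \ (Ω' ×ˢ closedBall 0 r)) ∧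
      ∀ G : EuclideanSpace ℂ (Fin l) × EuclideanSpace ℂ (Fin k) → ℂ,
        DifferentiableOn ℂ G (Ω' ×ˢ Ω'') →
        Set.EqOn G f ((Ω' ×ˢ Ω'') \ (Ω' ×ˢ closedBall 0 r)) →
        Set.EqOn G F (Ω' ×ˢ Ω'') := by
  classical
  have hD : (Ω' ×ˢ Ω'') \ (Ω' ×ˢ closedBall (0 : EuclideanSpace ℂ (Fin k)) r) =
      Ω' ×ˢ (Ω'' \ closedBall 0 r) := by
    ext ⟨z, w⟩
    simp only [Set.mem_sdiff, Set.mem_prod]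
    tauto
  rw [hD] at hf ⊢
  have hDo : IsOpen (Ω' ×ˢ (Ω'' \ closedBall (0 : EuclideanSpace ℂ (Fin k)) r)) :=
    hΩ'.prod (hΩ''.sdiff isClosed_closedBall)
  obtain ⟨δ, hδ, hsub⟩ := (isCompact_closedBall (0 : EuclideanSpace ℂ (Fin k)) r).exists_thickening_subset_open
    hΩ'' hball
  rw [thickening_closedBall hδ hr0.le] at hsub
  obtain ⟨R, hR⟩ : ∃ R, R = δ + r := ⟨_, rfl⟩
  rw [← hR] at hsub
  have hrR : r < R := by linarith
  have hmemD : ∀ z ∈ Ω', ∀ w ∈ Ω'', r < ‖w‖ →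
      (z, w) ∈ Ω' ×ˢ (Ω'' \ closedBall (0 : EuclideanSpace ℂ (Fin k)) r) := by
    intro z hz w hw h
    exact ⟨hz, hw, by simpa using h⟩
  obtain ⟨F₁, hF₁d, hF₁e⟩ := hartogs_local hk Ω' hΩ' r R hr0 hrR f (by
    intro z hz w h1 h2
    exact hf.differentiableAt (hDo.mem_nhds (hmemD z hz w (hsub (by simpa using h2)) h1)))
  let F : EuclideanSpace ℂ (Fin l) × EuclideanSpace ℂ (Fin k) → ℂ :=
    fun p => if ‖p.2‖ < R then F₁ p else f p
  have hFf : Set.EqOn F f (Ω' ×ˢ (Ω'' \ closedBall 0 r)) := by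
    rintro ⟨z, w⟩ ⟨hz, hw, hwr⟩
    have hwr' : r < ‖w‖ := by simpa using hwr
    by_cases h : ‖w‖ < R
    · simp only [F, h, if_true]
      exact hF₁e z hz w hwr' h
    · simp only [F, h, if_false]
  have hFd : DifferentiableOn ℂ F (Ω' ×ˢ Ω'') := by
    rintro ⟨z, w⟩ ⟨hz, hw⟩
    refine DifferentiableAt.differentiableWithinAt ?_
    by_cases h : ‖w‖ < R
    · refine (hF₁d z hz w h).congr_of_eventuallyEq ?_
      have hO : IsOpen {p : EuclideanSpace ℂ (Fin l) × EuclideanSpace ℂ (Fin k) | ‖p.2‖ < R} :=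
        isOpen_lt (by fun_prop) continuous_const
      filter_upwards [hO.mem_nhds h] with p hp
      exact if_pos hp
    · have hm := hDo.mem_nhds (hmemD z hz w hw (by linarith))
      refine (hf.differentiableAt hm).congr_of_eventuallyEq ?_
      filter_upwards [hm] with p hp
      exact hFf hp
  refine ⟨F, hFd, hFf, ?_⟩
  rintro G hGd hGf ⟨z, w⟩ ⟨hz, hw⟩
  have hslice : ∀ H : EuclideanSpace ℂ (Fin l) × EuclideanSpace ℂ (Fin k) → ℂ,
      DifferentiableOn ℂ H (Ω' ×ˢ Ω'') → DifferentiableOn ℂ (fun w => H (z, w)) Ω'' := by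
    intro H hH
    exact hH.comp (f := fun w => (z, w)) (by fun_prop) (fun w hw => ⟨hz, hw⟩)
  let w₀ : EuclideanSpace ℂ (Fin k) := EuclideanSpace.single ⟨0, by omega⟩ (((r + R) / 2 : ℝ) : ℂ)
  have hw0n : ‖w₀‖ = (r + R) / 2 := by
    simp only [w₀, PiLp.norm_single, Complex.norm_real]
    exact Real.norm_of_nonneg (by linarith)
  have hw0 : w₀ ∈ Ω'' := hsub (by rw [mem_ball_zero_iff, hw0n]; linarith)
  refine hartogs_identity (fun w => G (z, w)) (fun w => F (z, w)) Ω'' hΩ'' hconn.isPreconnected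
    (hslice G hGd) (hslice F hFd) w₀ hw0 ?_ hw
  have hO : IsOpen (Ω'' \ closedBall (0 : EuclideanSpace ℂ (Fin k)) r) :=
    hΩ''.sdiff isClosed_closedBall
  filter_upwards [hO.mem_nhds ⟨hw0, by rw [mem_closedBall_zero_iff, hw0n]; linarith⟩] with w' hw'
  exact (hGf (show (z, w') ∈ _ from ⟨hz, hw'⟩)).trans (hFf (show (z, w') ∈ _ from ⟨hz, hw'⟩)).symm
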